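/- An object c of D(A) is compact if and only if c is isomorphic in D(A) to a perfect complex, that is, to a bounded complex of finitely generated projective A-modules. -/

import Mathlib

/-!
Statement 4: an object of `D(A)` is compact if and only if it is isomorphic in `D(A)` to a
perfect complex, i.e. to a bounded complex of finitely generated projective `A`-modules.
-/

universe u

open CategoryTheory Limits Pretriangulated DirectSum

variable (A : Type u) [Ring A] [HasDerivedCategory (ModuleCat.{u} A)]

/-- An object `x` of `D(A)` is compact if for every small family `(t_j)` and every coproduct
`∐ t_j` of that family, the canonical map `⊕_j Hom(x, t_j) → Hom(x, ∐ t_j)` is bijective. -/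
def IsCompactObj (x : DerivedCategory (ModuleCat.{u} A)) : Prop :=
  ∀ (J : Type u) (t : J → DerivedCategory (ModuleCat.{u} A)) (c : Cofan t), IsColimit c →
    letI := Classical.decEq J
    Function.Bijective
      (DirectSum.toAddMonoid (fun j =>
        AddMonoidHom.mk' (fun g : x ⟶ t j => g ≫ c.inj j)
          (fun g g' => by simp [Preadditive.add_comp])) :
        (⨁ (j : J), (x ⟶ t j)) →+ (x ⟶ c.pt))

/-- A perfect complex: a bounded complex of finitely generated projective `A`-modules. -/
def IsPerfectComplex (K : CochainComplex (ModuleCat.{u} A) ℤ) : Prop :=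
  (∃ a b : ℤ, ∀ n : ℤ, (n < a ∨ b < n) → IsZero (K.X n)) ∧
  (∀ n : ℤ, Module.Finite A (K.X n) ∧ Module.Projective A (K.X n))

theorem quasiIso_of_restrictionMap {C : Type*} [Category C] [Abelian C]
    {ι ι' : Type*} {c : ComplexShape ι} {c' : ComplexShape ι'}
    (e : c.Embedding c') [e.IsRelIff] {K L : HomologicalComplex C c'} (φ : K ⟶ L)
    (hφ : QuasiIso (HomologicalComplex.restrictionMap φ e))
    (h : ∀ j', ∃ j, e.f j = j' ∧ c'.prev j' = e.f (c.prev j) ∧ c'.next j' = e.f (c.next j)) :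
    QuasiIso φ := ⟨fun j' => by
  obtain ⟨j, rfl, hp, hn⟩ := h j'
  have := hφ.quasiIsoAt j
  rw [quasiIsoAt_iff' _ _ _ _ rfl rfl] at this
  rw [quasiIsoAt_iff' _ _ _ _ hp hn]
  refine (ShortComplex.quasiIso_iff_of_arrow_mk_iso _ _ ?_).1 this
  exact Arrow.isoMk (HomologicalComplex.restriction.sc'Iso K e _ _ _ rfl rfl rfl hp hn)
    (HomologicalComplex.restriction.sc'Iso L e _ _ _ rfl rfl rfl hp hn) (by
      ext <;> simp only [Arrow.mk_left, Arrow.mk_right, Arrow.mk_hom, ShortComplex.comp_τ₁,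
        ShortComplex.comp_τ₂, ShortComplex.comp_τ₃] <;>
      exact (Category.id_comp _).trans (Category.comp_id _).symm)⟩

theorem exists_quasiIso_projective {C : Type*} [Category C] [Abelian C] [EnoughProjectives C]
    (K : CochainComplex C ℤ) (n : ℤ) [K.IsStrictlyLE n] :
    ∃ (P : CochainComplex C ℤ) (f : P ⟶ K) (_ : QuasiIso f),
      (∀ i, Projective (P.X i)) ∧ P.IsStrictlyLE n := by
  let e := CochainComplex.opEquivalence C
  let L := e.functor.obj (Opposite.op K)
  have : L.IsStrictlyGE (-n) := by
    rw [CochainComplex.isStrictlyGE_iff]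
    intro i hi
    exact (K.isZero_of_isStrictlyLE n (-i) (by lia)).op
  obtain ⟨I, i, hi, hI, hI'⟩ :=
    CochainComplex.Plus.modelCategoryQuillen.exists_quasiIso_injective L (-n)
  let P := (e.inverse.obj I).unop
  let f : P ⟶ K := (e.unitIso.hom.app (Opposite.op K) ≫ e.inverse.map i).unop
  have hf : QuasiIso (e.functor.map f.op) := by
    have : e.functor.map f.op = i ≫ e.counitIso.inv.app I := by
      simp [f]
    rw [this]
    infer_instance
  refine ⟨P, f, ?_, fun j => ?_, ?_⟩
  · rw [← HomologicalComplex.quasiIso_opFunctor_map_iff]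
    refine quasiIso_of_restrictionMap ComplexShape.embeddingUpIntDownInt _ hf fun j =>
      ⟨-j, ?_, ?_, ?_⟩
    all_goals simp [ComplexShape.embeddingUpIntDownInt]
    all_goals lia
  · have : Injective (I.X (-j)) := hI _
    exact Injective.projective_iff_injective_op |>.2 this
  · rw [CochainComplex.isStrictlyLE_iff]
    intro i hi
    exact (I.isZero_of_isStrictlyGE (-n) (-i) (by lia)).unop

theorem quasiIso_iff_elementwise {R : Type u} [Ring R]
    {K L : CochainComplex (ModuleCat.{u} R) ℤ} (f : K ⟶ L) :
    QuasiIso f ↔ ∀ i j k : ℤ, i + 1 = j → j + 1 = k →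
      (∀ (x : K.X j) (y : L.X i), K.d j k x = 0 → f.f j x = L.d i j y → ∃ w, x = K.d i j w) ∧
      (∀ y : L.X j, L.d j k y = 0 → ∃ x w, K.d j k x = 0 ∧ y = f.f j x + L.d i j w) := by
  rw [quasiIso_iff]
  have key (i j k : ℤ) (hij : i + 1 = j) (hjk : j + 1 = k) : QuasiIsoAt f j ↔
      (∀ (x : K.X j) (y : L.X i), K.d j k x = 0 → f.f j x = L.d i j y → ∃ w, x = K.d i j w) ∧
      (∀ y : L.X j, L.d j k y = 0 → ∃ x w, K.d j k x = 0 ∧ y = f.f j x + L.d i j w) := by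
    have hi : (ComplexShape.up ℤ).prev j = i := by simp; lia
    have hk : (ComplexShape.up ℤ).next j = k := by simp; lia
    rw [quasiIsoAt_iff_isIso_homologyMap, isIso_iff_mono_and_epi,
      HomologicalComplex.mono_homologyMap_iff_up_to_refinements f i j k hi hk,
      HomologicalComplex.epi_homologyMap_iff_up_to_refinements f i j k hi hk]
    refine and_congr ⟨fun H x y hx hxy => ?_, fun H N x hx y hxy => ?_⟩
      ⟨fun H y hy => ?_, fun H N y hy => ?_⟩
    · obtain ⟨N', π, hπ, z, hz⟩ := H (ModuleCat.ofHom (LinearMap.toSpanSingleton R _ x))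
        (by ext; simpa using hx) (ModuleCat.ofHom (LinearMap.toSpanSingleton R _ y))
        (by ext; simpa using hxy)
      obtain ⟨t, ht⟩ := (ModuleCat.epi_iff_surjective π).1 hπ (1 : R)
      have := ConcreteCategory.congr_hom hz t
      exact ⟨z t, by simpa [ht] using this⟩
    · have (n : N) : ∃ w, x n = K.d i j w :=
        H _ (y n) (ConcreteCategory.congr_hom hx n) (ConcreteCategory.congr_hom hxy n)
      choose w hw using this
      refine ⟨ModuleCat.of R (N →₀ R), ModuleCat.ofHom (Finsupp.linearCombination R id),
        (ModuleCat.epi_iff_surjective _).2 (Finsupp.linearCombination_id_surjective _ _),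
        ModuleCat.ofHom (Finsupp.linearCombination R w), ?_⟩
      ext n
      simp [hw]
    · obtain ⟨N', π, hπ, x, hx, z, hz⟩ := H (ModuleCat.ofHom (LinearMap.toSpanSingleton R _ y))
        (by ext; simpa using hy)
      obtain ⟨t, ht⟩ := (ModuleCat.epi_iff_surjective π).1 hπ (1 : R)
      have := ConcreteCategory.congr_hom hz t
      exact ⟨x t, z t, ConcreteCategory.congr_hom hx t, by simpa [ht] using this⟩
    · have (n : N) := H (y n) (ConcreteCategory.congr_hom hy n)
      choose x w hx hw using this
      refine ⟨ModuleCat.of R (N →₀ R), ModuleCat.ofHom (Finsupp.linearCombination R id),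
        (ModuleCat.epi_iff_surjective _).2 (Finsupp.linearCombination_id_surjective _ _),
        ModuleCat.ofHom (Finsupp.linearCombination R x), ?_,
        ModuleCat.ofHom (Finsupp.linearCombination R w), ?_⟩
      · ext n
        simp [hx]
      · ext n
        simp [hw]
  refine ⟨fun H i j k hij hjk => (key i j k hij hjk).1 (H j),
    fun H j => (key (j - 1) j (j + 1) (by lia) rfl).2 (H _ _ _ (by lia) rfl)⟩

theorem exists_cofan_proj {C : Type*} [Category C] [HasZeroMorphisms C] {J : Type*} {t : J → C}
    {c : Cofan t} (hc : IsColimit c) :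
    ∃ π : ∀ j, c.pt ⟶ t j, (∀ j, c.inj j ≫ π j = 𝟙 _) ∧ ∀ i j, i ≠ j → c.inj i ≫ π j = 0 := by
  classical
  refine ⟨fun j => Cofan.IsColimit.desc hc fun i => if h : i = j then eqToHom (by rw [h]) else 0,
    fun j => by simp, fun i j hij => by simp [hij]⟩

theorem exists_finset_eq_sum_inj_proj {R : Type u} [Ring R] {J : Type u}
    {L : J → CochainComplex (ModuleCat.{u} R) ℤ} {c : Cofan L} (hc : IsColimit c)
    {π : ∀ j, c.pt ⟶ L j} (hπ : ∀ j, c.inj j ≫ π j = 𝟙 _)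
    (hπ' : ∀ i j, i ≠ j → c.inj i ≫ π j = 0) (n : ℤ) (x : c.pt.X n) :
    ∃ S : Finset J, ∀ T, S ⊆ T → x = ∑ j ∈ T, (c.inj j).f n ((π j).f n x) := by
  classical
  have htop : ⨆ j, LinearMap.range ((c.inj j).f n).hom = ⊤ := by
    rw [← Submodule.ker_mkQ (⨆ j, LinearMap.range ((c.inj j).f n).hom), LinearMap.ker_eq_top]
    have : ModuleCat.ofHom (Submodule.mkQ (⨆ j, LinearMap.range ((c.inj j).f n).hom)) = 0 := by
      refine (isColimitOfPreserves (HomologicalComplex.eval _ _ n) hc).hom_ext fun ⟨j⟩ => ?_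
      ext y
      have : (c.inj j).f n y ∈ ⨆ j, LinearMap.range ((c.inj j).f n).hom :=
        (le_iSup (fun j => LinearMap.range ((c.inj j).f n).hom) j) ⟨y, rfl⟩
      exact (Submodule.Quotient.mk_eq_zero _).2 this
    simpa using congrArg ModuleCat.Hom.hom this
  have hx : x ∈ ⨆ j, LinearMap.range ((c.inj j).f n).hom := htop ▸ Submodule.mem_top
  induction hx using Submodule.iSup_induction' with
  | mem j x hx =>
    obtain ⟨y, rfl⟩ := hx
    refine ⟨{j}, fun T hT => ?_⟩
    rw [Finset.sum_eq_single_of_mem j (hT (by simp))]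
    · have := ConcreteCategory.congr_hom (HomologicalComplex.congr_hom (hπ j) n) y
      simp only [HomologicalComplex.comp_f, HomologicalComplex.id_f, ModuleCat.hom_comp,
        LinearMap.comp_apply] at this
      exact (congrArg ((c.inj j).f n) this).symm
    · intro i _ hij
      have := ConcreteCategory.congr_hom (HomologicalComplex.congr_hom (hπ' j i hij.symm) n) y
      simp only [HomologicalComplex.comp_f, ModuleCat.hom_comp, LinearMap.comp_apply] at this
      exact (congrArg ((c.inj i).f n) this).trans (map_zero _)
  | zero => exact ⟨∅, by simp⟩
  | add x y _ _ hx hy =>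
    obtain ⟨S, hS⟩ := hx
    obtain ⟨S', hS'⟩ := hy
    refine ⟨S ∪ S', fun T hT => ?_⟩
    simp only [map_add, Finset.sum_add_distrib]
    rw [← hS T (Finset.union_subset_left hT), ← hS' T (Finset.union_subset_right hT)]

theorem d_hom_apply {R : Type u} [Ring R] {K L : CochainComplex (ModuleCat.{u} R) ℤ} (f : K ⟶ L)
    (i j : ℤ) (x : K.X i) : L.d i j (f.f i x) = f.f j (K.d i j x) :=
  ConcreteCategory.congr_hom (f.comm i j) x

theorem comp_f_apply_eq {R : Type u} [Ring R] {K L L' M : CochainComplex (ModuleCat.{u} R) ℤ}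
    {f : K ⟶ L} {g : L ⟶ M} {f' : K ⟶ L'} {g' : L' ⟶ M} (h : f ≫ g = f' ≫ g') (i : ℤ) (x : K.X i) :
    g.f i (f.f i x) = g'.f i (f'.f i x) :=
  ConcreteCategory.congr_hom (HomologicalComplex.congr_hom h i) x

theorem quasiIso_of_isColimit_cofan {R : Type u} [Ring R] {J : Type u}
    {L L' : J → CochainComplex (ModuleCat.{u} R) ℤ} {c : Cofan L} (hc : IsColimit c)
    {c' : Cofan L'} (hc' : IsColimit c') (s : ∀ j, L j ⟶ L' j) (hs : ∀ j, QuasiIso (s j))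
    (f : c.pt ⟶ c'.pt) (hf : ∀ j, c.inj j ≫ f = s j ≫ c'.inj j) : QuasiIso f := by
  obtain ⟨π, h₁, h₂⟩ := exists_cofan_proj hc
  obtain ⟨π', h₁', h₂'⟩ := exists_cofan_proj hc'
  have hπ (j : J) : f ≫ π' j = π j ≫ s j := by
    refine Cofan.IsColimit.hom_ext hc _ _ fun i => ?_
    rw [reassoc_of% (hf i)]
    by_cases hij : i = j
    · subst hij
      rw [h₁', reassoc_of% (h₁ i), Category.comp_id]
    · rw [h₂' _ _ hij, reassoc_of% (h₂ _ _ hij), zero_comp, comp_zero]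
  rw [quasiIso_iff_elementwise]
  intro i k l hik hkl
  refine ⟨fun x y hx hxy => ?_, fun y hy => ?_⟩
  · have (j : J) : ∃ w, (π j).f k x = (L j).d i k w := by
      refine (((quasiIso_iff_elementwise (s j)).1 (hs j)) i k l hik hkl).1 _
        ((π' j).f i y) ?_ ?_
      · rw [d_hom_apply, hx, map_zero]
      · rw [← comp_f_apply_eq (hπ j), hxy, d_hom_apply]
    choose w hw using this
    obtain ⟨S, hS⟩ := exists_finset_eq_sum_inj_proj hc h₁ h₂ k x
    refine ⟨∑ j ∈ S, (c.inj j).f i (w j), (hS S subset_rfl).trans ?_⟩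
    rw [map_sum]
    exact Finset.sum_congr rfl fun j _ => by rw [hw, d_hom_apply]
  · have (j : J) := (((quasiIso_iff_elementwise (s j)).1 (hs j)) i k l hik hkl).2
      ((π' j).f k y) (by rw [d_hom_apply, hy, map_zero])
    choose x w hx hw using this
    obtain ⟨S, hS⟩ := exists_finset_eq_sum_inj_proj hc' h₁' h₂' k y
    refine ⟨∑ j ∈ S, (c.inj j).f k (x j), ∑ j ∈ S, (c'.inj j).f i (w j), ?_,
      (hS S subset_rfl).trans ?_⟩
    · rw [map_sum]
      exact Finset.sum_eq_zero fun j _ => by rw [d_hom_apply, hx, map_zero]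
    · rw [map_sum, map_sum, ← Finset.sum_add_distrib]
      exact Finset.sum_congr rfl fun j _ => by
        rw [hw, map_add, ← comp_f_apply_eq (hf j), d_hom_apply]

theorem exists_quasiIso_homotopy_of_Q_map_eq_zero {C : Type*} [Category C] [Abelian C]
    [HasDerivedCategory C] {K L : CochainComplex C ℤ} (f : K ⟶ L)
    (hf : DerivedCategory.Q.map f = 0) :
    ∃ (K' : CochainComplex C ℤ) (s : K' ⟶ K), QuasiIso s ∧ Nonempty (Homotopy (s ≫ f) 0) := by
  have h : DerivedCategory.Qh.map ((HomotopyCategory.quotient _ _).map f) =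
      DerivedCategory.Qh.map 0 := by
    rw [← cancel_mono ((DerivedCategory.quotientCompQhIso C).hom.app L),
      DerivedCategory.quotientCompQhIso_hom_naturality, hf, Functor.map_zero, comp_zero, zero_comp]
  obtain ⟨K', s, hs, h⟩ := (MorphismProperty.map_eq_iff_precomp DerivedCategory.Qh
    (HomotopyCategory.quasiIso C _) _ _).1 h
  obtain ⟨K', rfl⟩ := HomotopyCategory.quotient_obj_surjective K'
  obtain ⟨s, rfl⟩ := (HomotopyCategory.quotient _ _).map_surjective s
  refine ⟨K', s, ?_, ⟨HomotopyCategory.homotopyOfEq _ _ ?_⟩⟩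
  · rwa [HomotopyCategory.quotient_map_mem_quasiIso_iff] at hs
  · rw [Functor.map_comp, h, comp_zero, Functor.map_zero]

theorem nonempty_homotopy_zero_of_isColimit_cofan {R : Type u} [Ring R] {J : Type u}
    {L : J → CochainComplex (ModuleCat.{u} R) ℤ} {c : Cofan L} (hc : IsColimit c)
    {M : CochainComplex (ModuleCat.{u} R) ℤ} (f : c.pt ⟶ M)
    (h : ∀ j, Nonempty (Homotopy (c.inj j ≫ f) 0)) : Nonempty (Homotopy f 0) := by
  replace h := fun j => (h j).some
  let hc' (n : ℤ) := isColimitOfPreserves (HomologicalComplex.eval _ _ n) hc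
  let k (i j : ℤ) : c.pt.X i ⟶ M.X j :=
    (hc' i).desc ⟨_, Discrete.natTrans fun l => (h l.as).hom i j⟩
  have hk (l : J) (i j : ℤ) : (c.inj l).f i ≫ k i j = (h l).hom i j :=
    (hc' i).fac ⟨_, Discrete.natTrans fun l => (h l.as).hom i j⟩ ⟨l⟩
  refine ⟨⟨k, fun i j hij => (hc' i).hom_ext fun ⟨l⟩ => ?_, fun i => (hc' i).hom_ext fun ⟨l⟩ => ?_⟩⟩
  · exact (hk l i j).trans (((h l).zero i j hij).trans comp_zero.symm)
  · have := (h l).comm i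
    rw [dNext_eq _ (show (ComplexShape.up ℤ).Rel i (i + 1) by simp),
      prevD_eq _ (show (ComplexShape.up ℤ).Rel (i - 1) i by simp)] at this ⊢
    change (c.inj l).f i ≫ _ = (c.inj l).f i ≫ _
    rw [← hk, ← hk] at this
    simpa using this

open DerivedCategory in
theorem nonempty_isColimit_Q_cofan {R : Type u} [Ring R] [HasDerivedCategory (ModuleCat.{u} R)]
    {J : Type u} {L : J → CochainComplex (ModuleCat.{u} R) ℤ} {c : Cofan L} (hc : IsColimit c) :
    Nonempty (IsColimit (Cofan.mk (f := fun j => Q.obj (L j)) (Q.obj c.pt)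
      fun j => Q.map (c.inj j))) := by
  have uniq {M : DerivedCategory (ModuleCat.{u} R)} (f : Q.obj c.pt ⟶ M)
      (hf : ∀ j, Q.map (c.inj j) ≫ f = 0) : f = 0 := by
    obtain ⟨M', ⟨e⟩⟩ : ∃ M', Nonempty (Q.obj M' ≅ M) := ⟨_, ⟨Q.objObjPreimageIso M⟩⟩
    obtain ⟨N, g, s, hs, h⟩ := left_fac (f ≫ e.inv)
    have hg (j : J) : Q.map (c.inj j ≫ g) = 0 := by
      rw [IsIso.eq_comp_inv] at h
      simp [← h, reassoc_of% (hf j)]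
    choose L' t ht H using fun j => exists_quasiIso_homotopy_of_Q_map_eq_zero _ (hg j)
    let c' := coproductIsCoproduct L'
    let t' := Cofan.IsColimit.desc c' fun j => t j ≫ c.inj j
    have ht' (j : J) : Sigma.ι L' j ≫ t' = t j ≫ c.inj j := Cofan.IsColimit.fac c' _ j
    have : QuasiIso t' := quasiIso_of_isColimit_cofan c' hc t ht t' ht'
    obtain ⟨H'⟩ := nonempty_homotopy_zero_of_isColimit_cofan c' (t' ≫ g) fun j => by
      refine (H j).map fun H => (Homotopy.ofEq ?_).trans H
      exact (reassoc_of% (ht' j)) g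
    have hg : Q.map g = 0 := by
      have := Q_map_eq_of_homotopy _ H'
      rwa [Functor.map_comp, Functor.map_zero, Preadditive.IsIso.comp_left_eq_zero] at this
    rw [hg, zero_comp] at h
    rwa [Preadditive.IsIso.comp_right_eq_zero] at h
  have exist {M : DerivedCategory (ModuleCat.{u} R)} (f : ∀ j, Q.obj (L j) ⟶ M) :
      ∃ g : Q.obj c.pt ⟶ M, ∀ j, Q.map (c.inj j) ≫ g = f j := by
    obtain ⟨M', ⟨e⟩⟩ : ∃ M', Nonempty (Q.obj M' ≅ M) := ⟨_, ⟨Q.objObjPreimageIso M⟩⟩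
    choose L' t ht g hg using fun j => right_fac (f j ≫ e.inv)
    let c' := coproductIsCoproduct L'
    let t' := Cofan.IsColimit.desc c' fun j => t j ≫ c.inj j
    have ht' (j : J) : Sigma.ι L' j ≫ t' = t j ≫ c.inj j := Cofan.IsColimit.fac c' _ j
    have : QuasiIso t' := quasiIso_of_isColimit_cofan c' hc t
      (fun j => (isIso_Q_map_iff_quasiIso _ _).1 (ht j)) t' ht'
    let g' := Cofan.IsColimit.desc c' g
    have hg' (j : J) : Sigma.ι L' j ≫ g' = g j := Cofan.IsColimit.fac c' _ j
    refine ⟨inv (Q.map t') ≫ Q.map g' ≫ e.hom, fun j => ?_⟩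
    have : Q.map (c.inj j) ≫ inv (Q.map t') = inv (Q.map (t j)) ≫ Q.map (Sigma.ι L' j) := by
      rw [IsIso.comp_inv_eq, Category.assoc, IsIso.eq_inv_comp, ← Functor.map_comp,
        ← Functor.map_comp, ht']
    rw [reassoc_of% this, ← Functor.map_comp_assoc, hg', ← reassoc_of% (hg j)]
    simp
  choose desc hdesc using @exist
  refine ⟨Cofan.IsColimit.mk _ (fun s => desc s.inj) (fun s j => hdesc _ j) fun s m hm => ?_⟩
  rw [← sub_eq_zero]
  refine uniq _ fun j => ?_
  rw [Preadditive.comp_sub, sub_eq_zero, hdesc]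
  exact hm j

variable {A} in
theorem isCompactObj_iff_exists_finset (x : DerivedCategory (ModuleCat.{u} A)) :
    IsCompactObj A x ↔ ∀ (J : Type u) (t : J → DerivedCategory (ModuleCat.{u} A)) (c : Cofan t),
      IsColimit c → ∀ f : x ⟶ c.pt, ∃ (S : Finset J) (g : ∀ j, x ⟶ t j),
        f = ∑ j ∈ S, g j ≫ c.inj j := by
  classical
  refine forall₄_congr fun J t c hc => ⟨fun h f => ?_, fun h => ⟨?_, fun f => ?_⟩⟩
  · obtain ⟨d, hd⟩ := h.2 f
    refine ⟨DFinsupp.support d, fun j => d j, ?_⟩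
    rw [← hd, DirectSum.toAddMonoid, DFinsupp.liftAddHom_apply, DFinsupp.sumAddHom_apply]
    rfl
  · obtain ⟨π, h₁, h₂⟩ := exists_cofan_proj hc
    refine (injective_iff_map_eq_zero _).2 fun d hd => ?_
    rw [DirectSum.toAddMonoid, DFinsupp.liftAddHom_apply, DFinsupp.sumAddHom_apply] at hd
    ext j
    have := congrArg (fun f => f ≫ π j) hd
    rw [DFinsupp.sum, Preadditive.sum_comp, zero_comp] at this
    by_cases hj : j ∈ DFinsupp.support d
    · rw [Finset.sum_eq_single_of_mem j hj] at this
      · simpa [h₁] using this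
      · intro i _ hij
        simp [h₂ _ _ hij]
    · simpa using hj
  · obtain ⟨S, g, rfl⟩ := h f
    refine ⟨∑ j ∈ S, DirectSum.of (fun j => x ⟶ t j) j (g j), ?_⟩
    simp

theorem exists_Q_map_eq_of_isKProjective {C : Type*} [Category C] [Abelian C]
    [HasDerivedCategory C] {K L : CochainComplex C ℤ} [K.IsKProjective]
    (f : DerivedCategory.Q.obj K ⟶ DerivedCategory.Q.obj L) :
    ∃ g : K ⟶ L, DerivedCategory.Q.map g = f := by
  obtain ⟨g, hg⟩ := (CochainComplex.IsKProjective.Qh_map_bijective K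
    ((HomotopyCategory.quotient _ _).obj L)).2
      ((DerivedCategory.quotientCompQhIso C).hom.app K ≫ f ≫
        (DerivedCategory.quotientCompQhIso C).inv.app L)
  obtain ⟨g, rfl⟩ := (HomotopyCategory.quotient _ _).map_surjective g
  refine ⟨g, ?_⟩
  rw [← cancel_epi ((DerivedCategory.quotientCompQhIso C).hom.app K),
    ← DerivedCategory.quotientCompQhIso_hom_naturality, hg]
  simp

theorem nonempty_homotopy_of_Q_map_eq {C : Type*} [Category C] [Abelian C]
    [HasDerivedCategory C] {K L : CochainComplex C ℤ} [K.IsKProjective] {f g : K ⟶ L}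
    (h : DerivedCategory.Q.map f = DerivedCategory.Q.map g) : Nonempty (Homotopy f g) := by
  refine ⟨HomotopyCategory.homotopyOfEq _ _ ?_⟩
  refine (CochainComplex.IsKProjective.Qh_map_bijective K
    ((HomotopyCategory.quotient _ _).obj L)).1 ?_
  rw [← cancel_mono ((DerivedCategory.quotientCompQhIso C).hom.app L),
    DerivedCategory.quotientCompQhIso_hom_naturality, h,
    DerivedCategory.quotientCompQhIso_hom_naturality]

theorem exists_finset_hom_eq_sum {R : Type u} [Ring R] {J : Type u}
    {L : J → CochainComplex (ModuleCat.{u} R) ℤ} {c : Cofan L} (hc : IsColimit c)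
    {π : ∀ j, c.pt ⟶ L j} (hπ : ∀ j, c.inj j ≫ π j = 𝟙 _)
    (hπ' : ∀ i j, i ≠ j → c.inj i ≫ π j = 0) {K : CochainComplex (ModuleCat.{u} R) ℤ}
    {a b : ℤ} (hK : ∀ n, (n < a ∨ b < n) → IsZero (K.X n)) (hfg : ∀ n, Module.Finite R (K.X n))
    (f : K ⟶ c.pt) : ∃ S : Finset J, f = ∑ j ∈ S, f ≫ π j ≫ c.inj j := by
  classical
  have H (n : ℤ) : ∃ S : Finset J, ∀ T, S ⊆ T →
      f.f n = (∑ j ∈ T, f ≫ π j ≫ c.inj j).f n := by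
    choose S hS using exists_finset_eq_sum_inj_proj hc hπ hπ' n
    obtain ⟨s, hs⟩ := (hfg n).1
    refine ⟨s.biUnion fun x => S (f.f n x), fun T hT => ?_⟩
    ext1
    refine LinearMap.ext_on_range (v := ((↑) : s → K.X n)) (by simpa using hs) fun ⟨x, hx⟩ => ?_
    refine (hS (f.f n x) T ((Finset.subset_biUnion_of_mem _ hx).trans hT)).trans ?_
    have : (∑ j ∈ T, f ≫ π j ≫ c.inj j).f n = ∑ j ∈ T, (f ≫ π j ≫ c.inj j).f n :=
      map_sum (HomologicalComplex.Hom.fAddMonoidHom n) _ _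
    rw [this, ModuleCat.hom_sum, LinearMap.sum_apply]
    rfl
  choose S hS using H
  refine ⟨(Finset.Icc a b).biUnion S, ?_⟩
  ext1 n
  by_cases hn : n ∈ Finset.Icc a b
  · exact hS n _ (Finset.subset_biUnion_of_mem _ hn)
  · exact (hK n (by simp at hn; lia)).eq_of_src _ _

variable {A} in
open DerivedCategory in
theorem IsPerfectComplex.isCompactObj {K : CochainComplex (ModuleCat.{u} A) ℤ}
    (hK : IsPerfectComplex A K) {x : DerivedCategory (ModuleCat.{u} A)} (e : x ≅ Q.obj K) :
    IsCompactObj A x := by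
  obtain ⟨⟨a, b, hab⟩, hK⟩ := hK
  have : K.IsStrictlyLE b := by
    rw [CochainComplex.isStrictlyLE_iff]
    exact fun n hn => hab n (Or.inr hn)
  have (n : ℤ) : Projective (K.X n) :=
    (IsProjective.iff_projective (K.X n)).1 (hK n).2
  have := CochainComplex.isKProjective_of_projective K b
  rw [isCompactObj_iff_exists_finset]
  intro J t c hc f
  have (j : J) : ∃ M, Nonempty (Q.obj M ≅ t j) := ⟨_, ⟨Q.objObjPreimageIso (t j)⟩⟩
  choose L e' using this
  replace e' := fun j => (e' j).some
  let c' := coproductIsCoproduct L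
  obtain ⟨hc'⟩ := nonempty_isColimit_Q_cofan c'
  let φ := Cofan.IsColimit.desc hc' fun j => (e' j).hom ≫ c.inj j
  have hφ (j : J) : Q.map (Sigma.ι L j) ≫ φ = (e' j).hom ≫ c.inj j :=
    Cofan.IsColimit.fac hc' _ j
  let ψ := Cofan.IsColimit.desc hc fun j => (e' j).inv ≫ Q.map (Sigma.ι L j)
  have hψ (j : J) : c.inj j ≫ ψ = (e' j).inv ≫ Q.map (Sigma.ι L j) :=
    Cofan.IsColimit.fac hc _ j
  have hψφ : ψ ≫ φ = 𝟙 _ := Cofan.IsColimit.hom_ext hc _ _ fun j => by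
    rw [reassoc_of% (hψ j), hφ]
    simp
  obtain ⟨g, hg⟩ := exists_Q_map_eq_of_isKProjective (e.inv ≫ f ≫ ψ)
  obtain ⟨π, h₁, h₂⟩ := exists_cofan_proj c'
  obtain ⟨S, hS⟩ := exists_finset_hom_eq_sum c' h₁ h₂ hab (fun n => (hK n).1) g
  refine ⟨S, fun j => e.hom ≫ Q.map (g ≫ π j) ≫ (e' j).hom, ?_⟩
  have : f = e.hom ≫ Q.map g ≫ φ := by simp [hg, hψφ]
  have hQ : Q.map g = ∑ j ∈ S, Q.map (g ≫ π j ≫ Sigma.ι L j) := by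
    rw [← Functor.map_sum]
    exact congrArg Q.map hS
  rw [this, hQ, Preadditive.sum_comp, Preadditive.comp_sum]
  refine Finset.sum_congr rfl fun j _ => ?_
  simp only [Functor.map_comp, Category.assoc]
  rw [← hφ]

variable {A} in
theorem IsCompactObj.exists_finset {x : DerivedCategory (ModuleCat.{u} A)} (hx : IsCompactObj A x)
    {J : Type u} {t : J → DerivedCategory (ModuleCat.{u} A)} {c : Cofan t} (hc : IsColimit c)
    (f : x ⟶ c.pt) : ∃ S : Finset J, ∀ {y : DerivedCategory (ModuleCat.{u} A)} (θ : c.pt ⟶ y),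
      (∀ j ∈ S, c.inj j ≫ θ = 0) → f ≫ θ = 0 := by
  obtain ⟨S, g, rfl⟩ := (isCompactObj_iff_exists_finset x).1 hx J t c hc f
  refine ⟨S, fun θ hθ => ?_⟩
  rw [Preadditive.sum_comp]
  exact Finset.sum_eq_zero fun j hj => by rw [Category.assoc, hθ j hj, comp_zero]

variable {A} in
theorem IsCompactObj.of_iso {x y : DerivedCategory (ModuleCat.{u} A)} (hx : IsCompactObj A x)
    (e : x ≅ y) : IsCompactObj A y := by
  rw [isCompactObj_iff_exists_finset] at hx ⊢
  intro J t c hc f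
  obtain ⟨S, g, hg⟩ := hx J t c hc (e.hom ≫ f)
  refine ⟨S, fun j => e.inv ≫ g j, ?_⟩
  rw [← cancel_epi e.hom, hg, Preadditive.comp_sum]
  simp

/-- The map from a complex to its `m`-th object of opcycles, placed in degree `m`. -/
noncomputable def toSingleOpcycles {C : Type*} [Category C] [Abelian C] (L : CochainComplex C ℤ)
    (m : ℤ) : L ⟶ (HomologicalComplex.single C _ m).obj (L.opcycles m) :=
  HomologicalComplex.mkHomToSingle (L.pOpcycles m) fun i _ => L.d_pOpcycles i m

variable {A} in
open DerivedCategory in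
theorem IsCompactObj.exists_finset_Q_map_toSingleOpcycles
    {L : CochainComplex (ModuleCat.{u} A) ℤ} (hL : IsCompactObj A (Q.obj L)) :
    ∃ S : Finset ℤ, ∀ m ∉ S, Q.map (toSingleOpcycles L m) = 0 := by
  let T (m : ULift.{u} ℤ) : CochainComplex (ModuleCat.{u} A) ℤ :=
    (HomologicalComplex.single _ _ m.down).obj (L.opcycles m.down)
  let c := coproductIsCoproduct T
  obtain ⟨hc⟩ := nonempty_isColimit_Q_cofan c
  obtain ⟨π, h₁, h₂⟩ := exists_cofan_proj c
  let g : L ⟶ ∐ T :=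
    { f i := (toSingleOpcycles L i).f i ≫ (Sigma.ι T ⟨i⟩).f i
      comm' i j hij := by
        rw [Category.assoc, HomologicalComplex.Hom.comm,
          ← HomologicalComplex.Hom.comm_assoc]
        simp [T] }
  have hg (m : ℤ) : g ≫ π ⟨m⟩ = toSingleOpcycles L m := by
    refine HomologicalComplex.to_single_hom_ext ?_
    change ((toSingleOpcycles L m).f m ≫ (Sigma.ι T ⟨m⟩).f m) ≫ (π ⟨m⟩).f m = _
    rw [Category.assoc, ← HomologicalComplex.comp_f]
    erw [h₁ ⟨m⟩, Category.comp_id]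
  obtain ⟨S, hS⟩ := hL.exists_finset hc (Q.map g)
  refine ⟨S.image ULift.down, fun m hm => ?_⟩
  rw [← hg, Functor.map_comp]
  refine hS (Q.map (π ⟨m⟩)) fun j hj => ?_
  refine (Q.map_comp _ _).symm.trans ?_
  rw [h₂ _ _ fun h => hm (Finset.mem_image.2 ⟨j, hj, congrArg ULift.down h⟩), Functor.map_zero]

open HomologicalComplex in
theorem exactAt_of_Q_map_toSingleOpcycles_eq_zero {C : Type*} [Category C] [Abelian C]
    [HasDerivedCategory C] {L : CochainComplex C ℤ} {m : ℤ}
    (h : DerivedCategory.Q.map (toSingleOpcycles L m) = 0) : L.ExactAt m := by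
  have h₁ : homologyMap (toSingleOpcycles L m) m = 0 := by
    obtain ⟨K', s, hs, ⟨H⟩⟩ := exists_quasiIso_homotopy_of_Q_map_eq_zero _ h
    have := H.homologyMap_eq m
    rw [homologyMap_comp, homologyMap_zero] at this
    exact (Preadditive.IsIso.comp_left_eq_zero _ _).1 this
  have h₂ : opcyclesMap (toSingleOpcycles L m) m =
      (singleObjXSelf (.up ℤ) m (L.opcycles m)).inv ≫ pOpcycles _ m := by
    rw [← cancel_epi (L.pOpcycles m), p_opcyclesMap, toSingleOpcycles, mkHomToSingle_f,
      Category.assoc]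
  have := isIso_pOpcycles ((single C (.up ℤ) m).obj (L.opcycles m)) (m - 1) m (by simp) rfl
  have h₃ : L.homologyι m = 0 := by
    have := homologyι_naturality (toSingleOpcycles L m) m
    rw [h₁, zero_comp, h₂] at this
    simpa using this.symm
  rw [exactAt_iff_isZero_homology]
  exact IsZero.of_mono_eq_zero _ h₃

open HomologicalComplex in
theorem exists_eq_d_comp_of_Q_map_mkHomToSingle_eq_zero {C : Type*} [Category C] [Abelian C]
    [HasDerivedCategory C] {K : CochainComplex C ℤ} [K.IsKProjective] {m m' : ℤ} (hm : m + 1 = m')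
    {M : C} (φ : K.X m ⟶ M) (hφ : ∀ i, (ComplexShape.up ℤ).Rel i m → K.d i m ≫ φ = 0)
    (h : DerivedCategory.Q.map (mkHomToSingle φ hφ) = 0) :
    ∃ h : K.X m' ⟶ M, φ = K.d m m' ≫ h := by
  subst hm
  rw [← Functor.map_zero] at h
  obtain ⟨H⟩ := nonempty_homotopy_of_Q_map_eq h
  have := H.comm m
  rw [dNext_eq _ (show (ComplexShape.up ℤ).Rel m (m + 1) by simp),
      prevD_eq _ (show (ComplexShape.up ℤ).Rel (m - 1) m by simp)] at this
  refine ⟨H.hom (m + 1) m ≫ (singleObjXSelf (.up ℤ) m M).hom, ?_⟩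
  rw [← cancel_mono (singleObjXSelf (.up ℤ) m M).inv]
  simpa using this

theorem projective_opcycles {C : Type*} [Category C] [Abelian C] {K : CochainComplex C ℤ}
    {i j : ℤ} (hij : i + 1 = j) [Projective (K.X j)] (h : K.X j ⟶ K.opcycles i)
    (hh : K.pOpcycles i = K.d i j ≫ h) : Projective (K.opcycles j) := by
  let σ : K.opcycles j ⟶ K.X j := K.descOpcycles (𝟙 _ - h ≫ K.fromOpcycles i j) i
    (by simp; lia) (by
      rw [Preadditive.comp_sub, ← reassoc_of% hh, HomologicalComplex.p_fromOpcycles,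
        Category.comp_id, sub_self])
  have h₀ : K.fromOpcycles i j ≫ K.pOpcycles j = 0 := by
    rw [← cancel_epi (K.pOpcycles i), HomologicalComplex.p_fromOpcycles_assoc,
      HomologicalComplex.d_pOpcycles, comp_zero]
  refine Retract.projective ⟨σ, K.pOpcycles j, ?_⟩
  rw [← cancel_epi (K.pOpcycles j)]
  simp [σ, Preadditive.sub_comp, h₀]

variable {A} in
open DerivedCategory in
theorem IsCompactObj.exists_bounded_projective {x : DerivedCategory (ModuleCat.{u} A)}
    (hx : IsCompactObj A x) :
    ∃ (P : CochainComplex (ModuleCat.{u} A) ℤ) (a b : ℤ), P.IsStrictlyGE a ∧ P.IsStrictlyLE b ∧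
      (∀ n, Projective (P.X n)) ∧ Nonempty (x ≅ Q.obj P) := by
  obtain ⟨L, ⟨e⟩⟩ : ∃ L, Nonempty (Q.obj L ≅ x) := ⟨_, ⟨Q.objObjPreimageIso x⟩⟩
  obtain ⟨S, hS⟩ := (hx.of_iso e.symm).exists_finset_Q_map_toSingleOpcycles
  obtain ⟨b, hb⟩ := S.bddAbove
  have : L.IsLE b := by
    rw [CochainComplex.isLE_iff]
    exact fun i hi => exactAt_of_Q_map_toSingleOpcycles_eq_zero
      (hS i fun h => (hb (Finset.mem_coe.2 h)).not_gt hi)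
  have : QuasiIso (L.ιTruncLE b) := (CochainComplex.quasiIso_ιTruncLE_iff L b).2 inferInstance
  obtain ⟨P, s, hs, hP, hPb⟩ := exists_quasiIso_projective (L.truncLE b) b
  have := CochainComplex.isKProjective_of_projective P b
  let eP : Q.obj P ≅ x := asIso (Q.map s) ≪≫ asIso (Q.map (L.ιTruncLE b)) ≪≫ e
  obtain ⟨S, hS⟩ := (hx.of_iso eP.symm).exists_finset_Q_map_toSingleOpcycles
  obtain ⟨a, ha⟩ := S.bddBelow
  replace hS (m : ℤ) (hm : m < a) : Q.map (toSingleOpcycles P m) = 0 :=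
    hS m fun h => (ha (Finset.mem_coe.2 h)).not_gt hm
  have : P.IsGE a := by
    rw [CochainComplex.isGE_iff]
    exact fun i hi => exactAt_of_Q_map_toSingleOpcycles_eq_zero (hS i hi)
  have : QuasiIso (P.πTruncGE a) := (CochainComplex.quasiIso_πTruncGE_iff P a).2 inferInstance
  refine ⟨P.truncGE a, a, b, inferInstance, inferInstance, fun n => ?_,
    ⟨eP.symm ≪≫ asIso (Q.map (P.πTruncGE a))⟩⟩
  obtain hn | rfl | hn := lt_trichotomy n a
  · exact ((P.truncGE a).isZero_of_isStrictlyGE a n hn).projective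
  · obtain ⟨h, hh⟩ := exists_eq_d_comp_of_Q_map_mkHomToSingle_eq_zero
      (show n - 1 + 1 = n by lia) (P.pOpcycles (n - 1)) (fun i _ => P.d_pOpcycles i _)
      (hS (n - 1) (by lia))
    exact Projective.of_iso (P.truncGEXIsoOpcycles n).symm
      (projective_opcycles (by lia) h hh)
  · exact Projective.of_iso (P.truncGEXIso a n).symm (hP n)

/-- A morphism of modules whose range is contained in a finitely generated submodule. -/
def RangeLeFG {R : Type u} [Ring R] {M N : ModuleCat.{u} R} (f : M ⟶ N) : Prop :=
  ∃ S : Submodule R N, S.FG ∧ LinearMap.range f.hom ≤ S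

namespace RangeLeFG

variable {R : Type u} [Ring R] {M N L : ModuleCat.{u} R}

theorem zero : RangeLeFG (0 : M ⟶ N) :=
  ⟨⊥, Submodule.fg_bot, by simp⟩

theorem of_finite_source [Module.Finite R M] (f : M ⟶ N) : RangeLeFG f :=
  ⟨LinearMap.range f.hom, by rw [LinearMap.range_eq_map]; exact Module.Finite.fg_top.map _, le_rfl⟩

theorem precomp {f : M ⟶ N} (hf : RangeLeFG f) (g : L ⟶ M) : RangeLeFG (g ≫ f) := by
  obtain ⟨S, hS, h⟩ := hf
  exact ⟨S, hS, (LinearMap.range_comp_le_range _ _).trans h⟩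

theorem postcomp {f : M ⟶ N} (hf : RangeLeFG f) (g : N ⟶ L) : RangeLeFG (f ≫ g) := by
  obtain ⟨S, hS, h⟩ := hf
  refine ⟨S.map g.hom, hS.map _, ?_⟩
  rw [ModuleCat.hom_comp, LinearMap.range_comp]
  exact Submodule.map_mono h

theorem add {f g : M ⟶ N} (hf : RangeLeFG f) (hg : RangeLeFG g) : RangeLeFG (f + g) := by
  obtain ⟨S, hS, h⟩ := hf
  obtain ⟨T, hT, h'⟩ := hg
  refine ⟨S ⊔ T, hS.sup hT, ?_⟩
  rintro _ ⟨x, rfl⟩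
  exact Submodule.add_mem_sup (h ⟨x, rfl⟩) (h' ⟨x, rfl⟩)

theorem sum {ι : Type*} (s : Finset ι) (f : ι → (M ⟶ N)) (hf : ∀ i ∈ s, RangeLeFG (f i)) :
    RangeLeFG (∑ i ∈ s, f i) :=
  Finset.sum_induction f RangeLeFG (fun _ _ => add) zero hf

end RangeLeFG

section FreeModule

variable {R : Type u} [Ring R] {X : Type u}

/-- The endomorphism of the free module on `X` that projects onto the span of `J ⊆ X`. -/
noncomputable def finsuppTrunc (J : Finset X) :
    ModuleCat.of R (X →₀ R) ⟶ ModuleCat.of R (X →₀ R) :=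
  ∑ j ∈ J, ModuleCat.ofHom (Finsupp.lapply (R := R) (M := R) j) ≫
    ModuleCat.ofHom (Finsupp.lsingle j)

theorem rangeLeFG_finsuppTrunc (J : Finset X) : RangeLeFG (finsuppTrunc (R := R) J) :=
  RangeLeFG.sum _ _ fun _ _ => (RangeLeFG.of_finite_source _).precomp _

theorem finsuppTrunc_apply (J : Finset X) (x : X →₀ R) :
    (finsuppTrunc J).hom x = ∑ j ∈ J, Finsupp.single j (x j) := by
  simp [finsuppTrunc, ModuleCat.hom_sum]

theorem finsuppTrunc_apply_of_support_subset {J : Finset X} {x : X →₀ R} (hx : x.support ⊆ J) :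
    (finsuppTrunc J).hom x = x := by
  rw [finsuppTrunc_apply]
  conv_rhs => rw [← Finsupp.sum_single x, Finsupp.sum_of_support_subset _ hx _ (by simp)]

theorem lsingle_comp_finsuppTrunc {J : Finset X} {j : X} (hj : j ∈ J) :
    ModuleCat.ofHom (Finsupp.lsingle (R := R) (M := R) j) ≫ finsuppTrunc J =
      ModuleCat.ofHom (Finsupp.lsingle j) := by
  ext : 1
  refine LinearMap.ext fun r => finsuppTrunc_apply_of_support_subset ?_
  exact Finsupp.support_single_subset.trans (by simpa using hj)

theorem RangeLeFG.exists_comp_finsuppTrunc {M : ModuleCat.{u} R}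
    {g : M ⟶ ModuleCat.of R (X →₀ R)} (hg : RangeLeFG g) : ∃ J, g ≫ finsuppTrunc J = g := by
  classical
  obtain ⟨_, ⟨t, rfl⟩, h⟩ := hg
  let t' : Finset (X →₀ R) := t
  refine ⟨t'.biUnion Finsupp.support, ?_⟩
  have : Submodule.span R (t : Set (X →₀ R)) ≤
      LinearMap.eqLocus (finsuppTrunc (t'.biUnion Finsupp.support)).hom LinearMap.id :=
    Submodule.span_le.2 fun x hx => finsuppTrunc_apply_of_support_subset
      (Finset.subset_biUnion_of_mem Finsupp.support (s := t') hx)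
  ext : 1
  exact LinearMap.ext fun x => this (h ⟨x, rfl⟩)

/-- The free module on `X` is the coproduct of copies of the base ring. -/
noncomputable def isColimitCofanFinsupp :
    IsColimit (Cofan.mk (f := fun _ : X => ModuleCat.of R R) (ModuleCat.of R (X →₀ R))
      fun j => ModuleCat.ofHom (Finsupp.lsingle j)) :=
  Cofan.IsColimit.mk _ (fun s => ModuleCat.ofHom (Finsupp.lsum ℕ fun j => (s.inj j).hom))
    (fun s j => by
      ext : 1
      refine LinearMap.ext fun r => ?_
      simp)
    (fun s m h => by
      ext : 1
      refine Finsupp.lhom_ext' fun j => ?_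
      refine LinearMap.ext fun r => (congrArg (fun f => f.hom r) (h j)).trans ?_
      simp)

end FreeModule

variable {A} in
open DerivedCategory in
theorem IsCompactObj.exists_comp_finsuppTrunc {x : DerivedCategory (ModuleCat.{u} A)}
    (hx : IsCompactObj A x) {X : Type u} (m : ℤ)
    (φ : x ⟶ Q.obj ((HomologicalComplex.single _ _ m).obj (ModuleCat.of A (X →₀ A)))) :
    ∃ J : Finset X,
      φ ≫ Q.map ((HomologicalComplex.single _ _ m).map (𝟙 _ - finsuppTrunc J)) = 0 := by
  obtain ⟨h⟩ := nonempty_isColimit_Q_cofan (isColimitCofanMkObjOfIsColimit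
    (HomologicalComplex.single _ (.up ℤ) m) _ _ (isColimitCofanFinsupp (R := A) (X := X)))
  obtain ⟨J, hJ⟩ := hx.exists_finset h φ
  refine ⟨J, hJ _ fun j hj => ?_⟩
  refine (Q.map_comp _ _).symm.trans ?_
  refine (congrArg Q.map ((Functor.map_comp _ _ _).symm.trans
    ((congrArg _ ?_).trans (Functor.map_zero _ _ _)))).trans (Functor.map_zero _ _ _)
  rw [Preadditive.comp_sub, lsingle_comp_finsuppTrunc hj, Category.comp_id, sub_self]

theorem exists_Q_map_eq_zero_and_f {C : Type*} [Category C] [Abelian C] [HasDerivedCategory C]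
    (K L : CochainComplex C ℤ) {i j : ℤ} (hij : i + 1 = j) (k : K.X j ⟶ L.X i) :
    ∃ g : K ⟶ L, DerivedCategory.Q.map g = 0 ∧ g.f i = K.d i j ≫ k ∧
      ∀ n, n ≠ i → n ≠ j → g.f n = 0 := by
  classical
  subst hij
  let hom (p q : ℤ) : K.X p ⟶ L.X q :=
    if h : i + 1 = p ∧ i = q then eqToHom (by rw [h.1]) ≫ k ≫ eqToHom (by rw [h.2]) else 0
  have h₀ (p q : ℤ) (h : ¬ (i + 1 = p ∧ i = q)) : hom p q = 0 := dif_neg h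
  have hf (n : ℤ) := Homotopy.nullHomotopicMap_f (show (ComplexShape.up ℤ).Rel (n - 1) n by simp)
    (show (ComplexShape.up ℤ).Rel n (n + 1) by simp) hom
  refine ⟨Homotopy.nullHomotopicMap hom, ?_, ?_, fun n h₁ h₂ => ?_⟩
  · refine (DerivedCategory.Q_map_eq_of_homotopy _ (Homotopy.nullHomotopy hom fun p q h =>
      h₀ _ _ fun ⟨h₁, h₂⟩ => h ?_)).trans (Functor.map_zero _ _ _)
    subst h₁ h₂
    simp
  · rw [hf, h₀ i (i - 1) (by lia), zero_comp, add_zero]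
    simp [hom]
  · rw [hf, h₀ _ _ (by lia), h₀ _ _ (by lia), zero_comp, comp_zero, add_zero]

theorem exists_free_cover {R : Type u} [Ring R] (M : ModuleCat.{u} R) [Projective M] :
    ∃ (X : Type u) (s : M ⟶ ModuleCat.of R (X →₀ R)) (r : ModuleCat.of R (X →₀ R) ⟶ M),
      s ≫ r = 𝟙 M := by
  let r : ModuleCat.of R (M →₀ R) ⟶ M := ModuleCat.ofHom (Finsupp.linearCombination R id)
  have : Epi r := (ModuleCat.epi_iff_surjective r).2 (Finsupp.linearCombination_id_surjective R M)
  exact ⟨M, Projective.factorThru (𝟙 M) r, r, Projective.factorThru_comp _ _⟩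

variable {A} in
open DerivedCategory in
theorem IsCompactObj.exists_rangeLeFG_succ {P : CochainComplex (ModuleCat.{u} A) ℤ}
    [P.IsKProjective] [∀ n, Projective (P.X n)] (hP : IsCompactObj A (Q.obj P)) {f : P ⟶ P}
    (hf : Q.map f = 𝟙 _) (m : ℤ) (hm : RangeLeFG (f.f (m - 1))) :
    ∃ g : P ⟶ P, Q.map g = 𝟙 _ ∧ RangeLeFG (g.f m) ∧ ∀ i < m, g.f i = f.f i := by
  obtain ⟨X, s, r, hsr⟩ := exists_free_cover (P.X m)
  obtain ⟨J, hJ⟩ := ((hm.postcomp (P.d (m - 1) m)).postcomp s).exists_comp_finsuppTrunc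
  let ψ := f.f m ≫ s ≫ (𝟙 _ - finsuppTrunc J)
  have hψ (i : ℤ) (hi : (ComplexShape.up ℤ).Rel i m) : P.d i m ≫ ψ = 0 := by
    obtain rfl : i = m - 1 := by simp at hi; lia
    rw [← HomologicalComplex.Hom.comm_assoc, Preadditive.comp_sub, Preadditive.comp_sub,
      Preadditive.comp_sub, sub_eq_zero, Category.comp_id]
    simpa using hJ.symm
  obtain ⟨J₀, hJ₀⟩ := hP.exists_comp_finsuppTrunc m (Q.map (HomologicalComplex.mkHomToSingle ψ hψ))
  have hψ₀ (i : ℤ) (hi : (ComplexShape.up ℤ).Rel i m) :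
      P.d i m ≫ ψ ≫ (𝟙 _ - finsuppTrunc J₀) = 0 := by
    rw [reassoc_of% hψ i hi, zero_comp]
  obtain ⟨h, hh⟩ := exists_eq_d_comp_of_Q_map_mkHomToSingle_eq_zero (K := P) (rfl : m + 1 = m + 1)
    (ψ ≫ (𝟙 _ - finsuppTrunc J₀)) hψ₀ (by
      rw [← hJ₀, ← Functor.map_comp]
      congr 1
      refine HomologicalComplex.to_single_hom_ext ?_
      simp [HomologicalComplex.single_map_f_self])
  obtain ⟨g, hg₀, hg₁, hg₂⟩ := exists_Q_map_eq_zero_and_f P P (rfl : m + 1 = m + 1) (h ≫ r)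
  refine ⟨f - g, by rw [Functor.map_sub, hf, hg₀, sub_zero], ?_, fun i hi => ?_⟩
  · have : (f - g).f m = (f.f m ≫ s) ≫ (finsuppTrunc J ≫ (𝟙 _ - finsuppTrunc J₀) +
        finsuppTrunc J₀) ≫ r := by
      rw [HomologicalComplex.sub_f_apply, hg₁, ← Category.assoc, ← hh]
      simp only [ψ, Preadditive.sub_comp, Preadditive.comp_sub, Preadditive.add_comp,
        Preadditive.comp_add, Category.assoc, Category.comp_id, hsr]
      abel
    rw [this]
    exact (((rangeLeFG_finsuppTrunc J).postcomp _).add (rangeLeFG_finsuppTrunc J₀)).postcomp r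
      |>.precomp _
  · rw [HomologicalComplex.sub_f_apply, hg₂ i (by lia) (by lia), sub_zero]

variable {A} in
open DerivedCategory in
theorem IsCompactObj.exists_rangeLeFG {P : CochainComplex (ModuleCat.{u} A) ℤ} (a b : ℤ)
    [P.IsStrictlyGE a] [P.IsStrictlyLE b] [∀ n, Projective (P.X n)]
    (hP : IsCompactObj A (Q.obj P)) : ∃ f : P ⟶ P, Q.map f = 𝟙 _ ∧ ∀ i, RangeLeFG (f.f i) := by
  have := CochainComplex.isKProjective_of_projective P b
  have key (m : ℤ) (hm : a ≤ m) : ∃ f : P ⟶ P, Q.map f = 𝟙 _ ∧ ∀ i < m, RangeLeFG (f.f i) := by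
    induction m, hm using Int.leInduction with
    | base =>
      refine ⟨𝟙 P, Q.map_id P, fun i hi => ?_⟩
      rw [(P.isZero_of_isStrictlyGE a i hi).eq_of_src ((𝟙 P : P ⟶ P).f i) 0]
      exact RangeLeFG.zero
    | succ m _ ih =>
      obtain ⟨f, hf, hf'⟩ := ih
      obtain ⟨g, hg, hg₁, hg₂⟩ := hP.exists_rangeLeFG_succ hf m (hf' _ (by lia))
      refine ⟨g, hg, fun i hi => ?_⟩
      obtain rfl | hi := (Int.lt_add_one_iff.1 hi).eq_or_lt
      · exact hg₁
      · rw [hg₂ i hi]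
        exact hf' i hi
  obtain ⟨f, hf, hf'⟩ := key (max a (b + 1)) (le_max_left _ _)
  refine ⟨f, hf, fun i => ?_⟩
  obtain hi | hi := lt_or_ge i (max a (b + 1))
  · exact hf' i hi
  · rw [(P.isZero_of_isStrictlyLE b i (by have := le_max_right a (b + 1); lia)).eq_of_src (f.f i) 0]
    exact RangeLeFG.zero

section ReplaceTerm

variable {R : Type u} [Ring R] (P : CochainComplex (ModuleCat.{u} R) ℤ) (m : ℤ)
  {F : Type u} [AddCommGroup F] [Module R F] (φ : ∀ n, F →ₗ[R] P.X n)

/-- The terms of the complex obtained from `P` by replacing `P.X m` by `F` along `φ m : F → P.X m`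
and `P.X (m - 1)` by its pullback. -/
def replaceTermX (n : ℤ) : Submodule R (P.X n × F × F) where
  carrier := {x | (n + 1 ≠ m → x.2.1 = 0) ∧ (n ≠ m → x.2.2 = 0) ∧ (n = m → x.1 = φ n x.2.2) ∧
    (n + 1 = m → P.d n (n + 1) x.1 = φ (n + 1) x.2.1)}
  zero_mem' := by simp
  add_mem' := by
    rintro x y ⟨h₁, h₂, h₃, h₄⟩ ⟨h₁', h₂', h₃', h₄'⟩
    refine ⟨fun h => ?_, fun h => ?_, fun h => ?_, fun h => ?_⟩
    · simp [h₁ h, h₁' h]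
    · simp [h₂ h, h₂' h]
    · simp [h₃ h, h₃' h]
    · simp [h₄ h, h₄' h]
  smul_mem' := by
    rintro c x ⟨h₁, h₂, h₃, h₄⟩
    refine ⟨fun h => ?_, fun h => ?_, fun h => ?_, fun h => ?_⟩
    · simp [h₁ h]
    · simp [h₂ h]
    · simp [h₃ h]
    · simp [h₄ h]

/-- The differentials of `replaceTerm`. -/
def replaceTermD (i j : ℤ) : replaceTermX P m φ i →ₗ[R] replaceTermX P m φ j :=
  LinearMap.codRestrict _
    (((P.d i j).hom ∘ₗ LinearMap.fst _ _ _).prod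
      (LinearMap.prod 0 (if i + 1 = j then LinearMap.fst _ _ _ ∘ₗ LinearMap.snd _ _ _ else 0)) ∘ₗ
      Submodule.subtype _) (by
    rintro ⟨x, h₁, h₂, h₃, h₄⟩
    refine ⟨fun h => rfl, fun h => ?_, fun h => ?_, fun h => ?_⟩
    · by_cases hij : i + 1 = j
      · simpa [hij] using h₁ (by lia)
      · simp [hij]
    · by_cases hij : i + 1 = j
      · subst hij
        simpa using h₄ h
      · simp [hij]
    · simp [← ModuleCat.comp_apply])

theorem replaceTermD_fst (i j : ℤ) (x : replaceTermX P m φ i) :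
    (replaceTermD P m φ i j x).1.1 = P.d i j x.1.1 := rfl

theorem replaceTermD_snd_snd {i j : ℤ} (hij : i + 1 = j) (x : replaceTermX P m φ i) :
    (replaceTermD P m φ i j x).1.2.2 = x.1.2.1 := by
  simp [replaceTermD, hij]

theorem replaceTermX_ext {n : ℤ} {x y : replaceTermX P m φ n} (h₁ : x.1.1 = y.1.1)
    (h₂ : x.1.2.1 = y.1.2.1) (h₃ : x.1.2.2 = y.1.2.2) : x = y :=
  Subtype.ext (Prod.ext h₁ (Prod.ext h₂ h₃))

/-- The complex obtained from `P` by replacing `P.X m` by `F` along `φ m : F → P.X m`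
and `P.X (m - 1)` by its pullback. -/
def replaceTerm : CochainComplex (ModuleCat.{u} R) ℤ where
  X n := ModuleCat.of R (replaceTermX P m φ n)
  d i j := ModuleCat.ofHom (replaceTermD P m φ i j)
  shape i j hij := by
    ext : 1
    refine LinearMap.ext fun x => replaceTermX_ext P m φ ?_ rfl ?_
    · simp [replaceTermD_fst, P.shape i j hij]
    · have : ¬ i + 1 = j := hij
      simp [replaceTermD, this]
  d_comp_d' i j k hij hjk := by
    ext : 1
    refine LinearMap.ext fun x => replaceTermX_ext P m φ ?_ rfl ?_
    · simp [replaceTermD_fst, ← ModuleCat.comp_apply]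
    · exact (replaceTermD_snd_snd P m φ hjk _).trans rfl

/-- The projection of `replaceTerm` to the original complex. -/
def replaceTermπ : replaceTerm P m φ ⟶ P where
  f _ := ModuleCat.ofHom (LinearMap.fst _ _ _ ∘ₗ Submodule.subtype _)
  comm' _ _ _ := rfl

theorem quasiIso_replaceTermπ
    (hφ : ∀ i j, i + 1 = j → j = m → ∀ y : P.X j, ∃ b z, y = φ j b + P.d i j z) :
    QuasiIso (replaceTermπ P m φ) := by
  rw [quasiIso_iff_elementwise]
  rintro i j k hij hjk
  refine ⟨fun (x : replaceTermX P m φ j) y hx hxy => ?_, fun y hy => ?_⟩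
  · replace hxy : x.1.1 = P.d i j y := hxy
    have hx₁ : x.1.2.1 = 0 := by
      rw [← replaceTermD_snd_snd P m φ hjk]
      exact congrArg (fun z : replaceTermX P m φ k => z.1.2.2) hx
    obtain ⟨-, h₂, h₃, -⟩ := x.2
    suffices ∃ w : replaceTermX P m φ i, P.d i j w.1.1 = x.1.1 ∧ w.1.2.1 = x.1.2.2 by
      obtain ⟨w, hw₁, hw₂⟩ := this
      exact ⟨w, replaceTermX_ext P m φ hw₁.symm hx₁
        (hw₂.symm.trans (replaceTermD_snd_snd P m φ hij w).symm)⟩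
    by_cases hi : i = m
    · obtain ⟨b, z, rfl⟩ := hφ (i - 1) i (by lia) hi y
      refine ⟨⟨(φ i b, 0, b), fun _ => rfl, fun h => (h hi).elim, fun _ => rfl,
        fun h => by lia⟩, ?_, (h₂ (by lia)).symm⟩
      rw [hxy]
      simp [← ModuleCat.comp_apply]
    · refine ⟨⟨(y, x.1.2.2, 0), fun h => h₂ (by lia), fun _ => rfl, fun h => (hi h).elim,
        fun h => ?_⟩, hxy.symm, rfl⟩
      subst hij
      exact hxy.symm.trans (h₃ h)
  · suffices ∃ (x : replaceTermX P m φ j) (w : P.X i), x.1.2.1 = 0 ∧ y = x.1.1 + P.d i j w by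
      obtain ⟨x, w, hx, hy'⟩ := this
      refine ⟨x, w, replaceTermX_ext P m φ ?_ rfl ((replaceTermD_snd_snd P m φ hjk _).trans hx),
        hy'⟩
      rw [hy'] at hy
      change P.d j k x.1.1 = 0
      simpa [← ModuleCat.comp_apply] using hy
    by_cases hj : j = m
    · obtain ⟨b, z, rfl⟩ := hφ i j hij hj y
      exact ⟨⟨(φ j b, 0, b), fun _ => rfl, fun h => (h hj).elim, fun _ => rfl, fun h => by lia⟩,
        z, rfl, rfl⟩
    · refine ⟨⟨(y, 0, 0), fun _ => rfl, fun _ => rfl, fun h => (hj h).elim, fun h => ?_⟩, 0,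
        rfl, by simp⟩
      subst hjk
      simpa using hy

/-- Away from degrees `m - 1` and `m`, the complex `replaceTerm` agrees with the original one. -/
def replaceTermXEquiv {n : ℤ} (h : n ≠ m) (h' : n + 1 ≠ m) : (replaceTerm P m φ).X n ≃ₗ[R] P.X n :=
  LinearEquiv.ofLinearMap ((replaceTermπ P m φ).f n).hom
    (LinearMap.codRestrict (replaceTermX P m φ n) (LinearMap.inl _ _ _) fun _ =>
      ⟨fun _ => rfl, fun _ => rfl, fun e => (h e).elim, fun e => (h' e).elim⟩)
    rfl
    (LinearMap.ext fun (x : replaceTermX P m φ n) =>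
      replaceTermX_ext P m φ rfl (x.2.1 h').symm (x.2.2.1 h).symm)

/-- In degree `m`, the complex `replaceTerm` is `F`. -/
def replaceTermXSelfEquiv : (replaceTerm P m φ).X m ≃ₗ[R] F :=
  LinearEquiv.ofLinearMap
    (LinearMap.snd _ _ _ ∘ₗ LinearMap.snd _ _ _ ∘ₗ (replaceTermX P m φ m).subtype)
    (LinearMap.codRestrict (replaceTermX P m φ m) ((φ m).prod (LinearMap.inr _ _ _)) fun _ =>
      ⟨fun _ => rfl, fun e => (e rfl).elim, fun _ => rfl, fun e => by lia⟩)
    rfl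
    (LinearMap.ext fun (x : replaceTermX P m φ m) =>
      replaceTermX_ext P m φ (x.2.2.2.1 rfl).symm (x.2.1 (by lia)).symm rfl)

theorem projective_replaceTerm_X {n : ℤ} (hn : n + 1 = m) [Module.Projective R F]
    [Module.Projective R (P.X n)] [Module.Projective R (P.X (n + 1))]
    (hφ : ∀ y : P.X (n + 1), ∃ b z, y = φ (n + 1) b + P.d n (n + 1) z) :
    Module.Projective R ((replaceTerm P m φ).X n) := by
  let τ : P.X n × F →ₗ[R] P.X (n + 1) := LinearMap.coprod (P.d n (n + 1)).hom (-φ (n + 1))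
  obtain ⟨σ, hσ⟩ := Module.projective_lifting_property τ LinearMap.id fun y => by
    obtain ⟨b, z, rfl⟩ := hφ y
    exact ⟨(z, -b), by simp [τ, add_comm]⟩
  have hτ (x : P.X n × F) : τ x = P.d n (n + 1) x.1 - φ (n + 1) x.2 := by
    simp [τ, sub_eq_add_neg]
  let ι : replaceTermX P m φ n →ₗ[R] P.X n × F :=
    LinearMap.prodMap LinearMap.id (LinearMap.fst _ _ _) ∘ₗ Submodule.subtype _
  have hι (x : replaceTermX P m φ n) : τ (ι x) = 0 :=
    (hτ _).trans (sub_eq_zero.2 (x.2.2.2.2 hn))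
  let ρ : P.X n × F →ₗ[R] replaceTermX P m φ n :=
    LinearMap.codRestrict _ (LinearMap.prodMap LinearMap.id (LinearMap.inl _ _ _) ∘ₗ
      (LinearMap.id - σ ∘ₗ τ)) fun x => by
    refine ⟨fun h => (h hn).elim, fun _ => rfl, fun h => by lia, fun _ => ?_⟩
    have : τ (x - σ (τ x)) = 0 := by
      rw [map_sub, sub_eq_zero]
      exact (LinearMap.congr_fun hσ (τ x)).symm
    exact sub_eq_zero.1 ((hτ _).symm.trans this)
  refine Module.Projective.of_split ι ρ (LinearMap.ext fun (x : replaceTermX P m φ n) => ?_)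
  have : ι x - σ (τ (ι x)) = ι x := by rw [hι, map_zero, sub_zero]
  exact replaceTermX_ext P m φ (congrArg Prod.fst this :) (congrArg Prod.snd this :)
    (x.2.2.1 (by lia)).symm

end ReplaceTerm

theorem exists_eq_d_add_of_rangeLeFG {R : Type u} [Ring R]
    {P : CochainComplex (ModuleCat.{u} R) ℤ}
    {f : P ⟶ P} (H : Homotopy (𝟙 P) f) {m : ℤ} (hf : RangeLeFG (f.f m))
    [Module.Finite R (P.X (m + 1))] :
    ∃ (k : ℕ) (φ : (Fin k → R) →ₗ[R] P.X m),
      ∀ i, i + 1 = m → ∀ y, ∃ b z, y = φ b + P.d i m z := by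
  obtain ⟨S, hS, h⟩ := (RangeLeFG.of_finite_source (H.hom (m + 1) m)).precomp (P.d m (m + 1))
    |>.add hf
  obtain ⟨k, φ, rfl⟩ := (Submodule.fg_iff_exists_fin_linearMap R _).1 hS
  refine ⟨k, φ, fun i hi y => ?_⟩
  obtain ⟨b, hb⟩ := h ⟨y, rfl⟩
  refine ⟨b, (H.hom m i).hom y, ?_⟩
  have := H.comm m
  rw [dNext_eq _ (show (ComplexShape.up ℤ).Rel m (m + 1) by simp),
    prevD_eq _ (show (ComplexShape.up ℤ).Rel i m from hi)] at this
  have := ConcreteCategory.congr_hom this y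
  rw [hb]
  refine this.trans ?_
  simp
  abel

variable {A} in
open DerivedCategory in
/-- One step of the top-down replacement of the terms of a bounded complex of projective modules
by finitely generated ones. -/
theorem exists_finite_X_of_rangeLeFG {P : CochainComplex (ModuleCat.{u} A) ℤ} {a b m : ℤ}
    [P.IsStrictlyGE a] [P.IsStrictlyLE b] [∀ n, Projective (P.X n)] (hm : a < m)
    (hfin : ∀ n, m < n → Module.Finite A (P.X n))
    {f : P ⟶ P} (hf : Q.map f = 𝟙 _) (hf' : ∀ i, RangeLeFG (f.f i)) (hmb : m ≤ b) :
    ∃ (P' : CochainComplex (ModuleCat.{u} A) ℤ) (f' : P' ⟶ P'), P'.IsStrictlyGE a ∧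
      P'.IsStrictlyLE b ∧ (∀ n, Projective (P'.X n)) ∧ (∀ n, m ≤ n → Module.Finite A (P'.X n)) ∧
      Q.map f' = 𝟙 _ ∧ (∀ i, RangeLeFG (f'.f i)) ∧ Nonempty (Q.obj P' ≅ Q.obj P) := by
  classical
  have := CochainComplex.isKProjective_of_projective P b
  have := hfin (m + 1) (by lia)
  obtain ⟨H⟩ := nonempty_homotopy_of_Q_map_eq ((Q.map_id P).trans hf.symm)
  obtain ⟨k, φ, hφ⟩ := exists_eq_d_add_of_rangeLeFG H (hf' m)
  let ψ : ∀ n, (Fin k → A) →ₗ[A] P.X n := Pi.single m φ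
  replace hφ (i j : ℤ) (hij : i + 1 = j) (hj : j = m) (y : P.X j) :
      ∃ b z, y = ψ j b + P.d i j z := by
    subst hj
    simpa [ψ] using hφ i hij y
  let u := replaceTermπ P m ψ
  have : QuasiIso u := quasiIso_replaceTermπ P m ψ hφ
  obtain ⟨v, hv⟩ := exists_Q_map_eq_of_isKProjective (inv (Q.map u))
  have (n : ℤ) : Module.Projective A (P.X n) :=
    (IsProjective.iff_projective (P.X n)).2 inferInstance
  refine ⟨replaceTerm P m ψ, u ≫ f ≫ v, ?_, ?_, fun n => ?_, fun n hn => ?_, by simp [hf, hv],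
    fun i => ((hf' i).postcomp _).precomp _, ⟨asIso (Q.map u)⟩⟩
  · rw [CochainComplex.isStrictlyGE_iff]
    intro i hi
    exact (P.isZero_of_isStrictlyGE a i hi).of_iso
      (replaceTermXEquiv P m ψ (by lia) (by lia)).toModuleIso
  · rw [CochainComplex.isStrictlyLE_iff]
    intro i hi
    exact (P.isZero_of_isStrictlyLE b i hi).of_iso
      (replaceTermXEquiv P m ψ (by lia) (by lia)).toModuleIso
  · refine (IsProjective.iff_projective _).1 ?_
    by_cases h₁ : n = m
    · subst h₁
      exact Module.Projective.of_equiv (replaceTermXSelfEquiv P n ψ).symm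
    · by_cases h₂ : n + 1 = m
      · exact projective_replaceTerm_X P m ψ h₂ (hφ n (n + 1) rfl h₂)
      · exact Module.Projective.of_equiv (replaceTermXEquiv P m ψ h₁ h₂).symm
  · obtain rfl | hn := hn.eq_or_lt
    · exact Module.Finite.equiv (replaceTermXSelfEquiv P m ψ).symm
    · have := hfin n hn
      exact Module.Finite.equiv (replaceTermXEquiv P m ψ (n := n) (by lia) (by lia)).symm

variable {A} in
open DerivedCategory in
theorem exists_isPerfectComplex_of_rangeLeFG {a b : ℤ} (m : ℤ) (ham : a ≤ m)
    (P : CochainComplex (ModuleCat.{u} A) ℤ)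
    [P.IsStrictlyGE a] [P.IsStrictlyLE b] [∀ n, Projective (P.X n)]
    (hfin : ∀ n, m < n → Module.Finite A (P.X n)) {f : P ⟶ P} (hf : Q.map f = 𝟙 _)
    (hf' : ∀ i, RangeLeFG (f.f i)) (hmb : m ≤ b) :
    ∃ K, IsPerfectComplex A K ∧ Nonempty (Q.obj P ≅ Q.obj K) := by
  induction m, ham using Int.leInduction generalizing P with
  | base =>
    have := CochainComplex.isKProjective_of_projective P b
    have := hfin (a + 1) (by lia)
    obtain ⟨H⟩ := nonempty_homotopy_of_Q_map_eq ((Q.map_id P).trans hf.symm)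
    obtain ⟨k, φ, hφ⟩ := exists_eq_d_add_of_rangeLeFG H (hf' a)
    refine ⟨P, ⟨⟨a, b, ?_⟩, fun n => ⟨?_, (IsProjective.iff_projective (P.X n)).2 inferInstance⟩⟩,
      ⟨Iso.refl _⟩⟩
    · rintro n (hn | hn)
      exacts [P.isZero_of_isStrictlyGE a n hn, P.isZero_of_isStrictlyLE b n hn]
    · obtain hn | rfl | hn := lt_trichotomy n a
      · have := ModuleCat.subsingleton_of_isZero (P.isZero_of_isStrictlyGE a n hn)
        infer_instance
      · refine Module.Finite.of_surjective φ fun y => ?_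
        obtain ⟨b, z, rfl⟩ := hφ (n - 1) (by lia) y
        rw [(P.isZero_of_isStrictlyGE n (n - 1) (by lia)).eq_of_src (P.d (n - 1) n) 0]
        exact ⟨b, by simp⟩
      · exact hfin n hn
  | succ m ham ih =>
    obtain ⟨P', f', _, _, _, h₁, h₂, h₃, ⟨e⟩⟩ :=
      exists_finite_X_of_rangeLeFG (a := a) (b := b) (by lia) hfin hf hf' hmb
    obtain ⟨K, hK, ⟨e'⟩⟩ := ih P' (fun n hn => h₁ n hn) h₂ h₃ (by lia)
    exact ⟨K, hK, ⟨e.symm ≪≫ e'⟩⟩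

theorem isCompactObj_iff_perfect (x : DerivedCategory (ModuleCat.{u} A)) :
    IsCompactObj A x ↔
      ∃ K : CochainComplex (ModuleCat.{u} A) ℤ, IsPerfectComplex A K ∧
        Nonempty (x ≅ DerivedCategory.Q.obj K) := by
  refine ⟨fun hx => ?_, fun ⟨K, hK, ⟨e⟩⟩ => hK.isCompactObj e⟩
  obtain ⟨P, a, b, _, _, _, ⟨e⟩⟩ := hx.exists_bounded_projective
  have : P.IsStrictlyLE (max a b) := P.isStrictlyLE_of_le b _ (le_max_right a b)
  obtain ⟨f, hf, hf'⟩ := (hx.of_iso e).exists_rangeLeFG a (max a b)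
  obtain ⟨K, hK, ⟨e'⟩⟩ := exists_isPerfectComplex_of_rangeLeFG (max a b) (le_max_left a b) P
    (fun n hn => by
      have := ModuleCat.subsingleton_of_isZero (P.isZero_of_isStrictlyLE (max a b) n hn)
      infer_instance) hf hf' le_rfl
  exact ⟨K, hK, ⟨e ≪≫ e'⟩⟩
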